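/- Fix positive integers a, b and a nonnegative integer c. There exist constants c₁, c₂ > 0, depending only on a, b, c, such that for every integer n ≥ 2 and every real p ∈ [1,∞), c₁ · n^{2/p} ≤ M_p(x₁²)/M_p(1) ≤ c₂ · n^{2/p}. -/

import Mathlib

open MeasureTheory Real

/-- The density `∏_{i<j} |x_i^a - x_j^a|^b · ∏_i |x_i|^c` on `ℝⁿ`. -/
noncomputable def fabc (n a b c : ℕ) (x : Fin n → ℝ) : ℝ :=
  (∏ i : Fin n, ∏ j : Fin n, if i < j then |x i ^ a - x j ^ a| ^ b else 1) *
    ∏ i : Fin n, |x i| ^ c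

/-- `M_p(g) = ∫ g(x) f_{a,b,c}(x) exp(-‖x‖_p^p) dx`. -/
noncomputable def Mp (n a b c : ℕ) (p : ℝ) (g : (Fin n → ℝ) → ℝ) : ℝ :=
  ∫ x : Fin n → ℝ, g x * fabc n a b c x * Real.exp (-∑ i, |x i| ^ p)

lemma fabc_nonneg (n a b c : ℕ) (x : Fin n → ℝ) : 0 ≤ fabc n a b c x := by
  unfold fabc
  refine mul_nonneg (Finset.prod_nonneg fun i _ => Finset.prod_nonneg fun j _ => ?_)
    (Finset.prod_nonneg fun i _ => by positivity)
  split_ifs <;> positivity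

lemma fabc_continuous (n a b c : ℕ) : Continuous (fabc n a b c) := by
  unfold fabc
  refine Continuous.mul (continuous_finsetProd _ fun i _ => continuous_finsetProd _ fun j _ => ?_)
    (continuous_finsetProd _ fun i _ => by fun_prop)
  split_ifs <;> fun_prop

/-- polynomial growth weight -/
noncomputable def PW (n : ℕ) (x : Fin n → ℝ) : ℝ := ∏ i, (1 + |x i|)

lemma one_le_PW (n : ℕ) (x : Fin n → ℝ) : 1 ≤ PW n x := by
  unfold PW
  exact Finset.one_le_prod (fun i => by simp)

lemma abs_le_PW (n : ℕ) (x : Fin n → ℝ) (i : Fin n) : |x i| ≤ PW n x := by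
  have h := Finset.prod_le_prod_of_subset_of_one_le (f := fun i => (1 + |x i|))
    (Finset.subset_univ {i}) (by intros; positivity) (by intros; simp)
  simp only [Finset.prod_singleton] at h
  unfold PW
  linarith

lemma fabc_le (n a b c : ℕ) (ha : 1 ≤ a) : ∃ L : ℕ, ∀ x, fabc n a b c x ≤ PW n x ^ L := by
  refine ⟨n * (a * b) + n * (a * b) + c, fun x => ?_⟩
  unfold fabc
  rw [pow_add]
  have h1 : (∏ i : Fin n, |x i| ^ c) ≤ PW n x ^ c := by
    rw [Finset.prod_pow]
    refine pow_le_pow_left₀ (Finset.prod_nonneg fun _ _ => abs_nonneg _) ?_ _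
    exact Finset.prod_le_prod (fun _ _ => abs_nonneg _) (fun _ _ => by linarith)
  have h2 : (∏ i : Fin n, ∏ j : Fin n, if i < j then |x i ^ a - x j ^ a| ^ b else 1)
      ≤ PW n x ^ (n * (a * b) + n * (a * b)) := by
    calc _ ≤ ∏ i : Fin n, ∏ j : Fin n, ((1 + |x i|) ^ (a * b) * (1 + |x j|) ^ (a * b)) := by
          refine Finset.prod_le_prod (fun i _ => Finset.prod_nonneg fun j _ => ?_)
            fun i _ => Finset.prod_le_prod (fun j _ => ?_) fun j _ => ?_
          · split_ifs <;> positivity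
          · split_ifs <;> positivity
          · split_ifs with h
            · rw [pow_mul, pow_mul, ← mul_pow]
              refine pow_le_pow_left₀ (abs_nonneg _) ?_ _
              have e1 := pow_add_pow_le (n := a) zero_le_one (abs_nonneg (x i)) (by omega)
              have e2 := pow_add_pow_le (n := a) zero_le_one (abs_nonneg (x j)) (by omega)
              rw [one_pow] at e1 e2
              have e3 := abs_sub (x i ^ a) (x j ^ a)
              rw [abs_pow, abs_pow] at e3
              have e4 : 0 ≤ |x i| ^ a := by positivity
              have e5 : 0 ≤ |x j| ^ a := by positivity
              nlinarith
            · have e1 : 1 ≤ (1 + |x i|) ^ (a * b) := one_le_pow₀ (by simp)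
              have e2 : 1 ≤ (1 + |x j|) ^ (a * b) := one_le_pow₀ (by simp)
              nlinarith
      _ = _ := by
          simp only [Finset.prod_mul_distrib, Finset.prod_pow, Finset.prod_const, Finset.card_univ,
            Fintype.card_fin]
          rw [pow_add, PW, pow_mul _ n]
  exact mul_le_mul h2 h1 (Finset.prod_nonneg fun i _ => by positivity)
    (pow_nonneg (by linarith [one_le_PW n x]) _)

lemma int1 (K : ℕ) (p : ℝ) (hp : 1 ≤ p) :
    Integrable (fun x : ℝ => (1 + |x|) ^ K * Real.exp (-|x| ^ p)) := by
  have h := (integrable_one_add_norm (E := ℝ) (μ := volume) (r := 2) (by simp)).const_mul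
    (Real.exp 2 * (K + 2).factorial)
  refine h.mono' ?_ (Filter.Eventually.of_forall fun x => ?_)
  · refine Continuous.aestronglyMeasurable ?_
    have : Continuous fun x : ℝ => |x| ^ p :=
      continuous_abs.rpow_const (fun x => Or.inr (by linarith))
    fun_prop
  · have hpos : 0 < 1 + |x| := by positivity
    rw [Real.norm_eq_abs, abs_of_nonneg (by positivity), Real.norm_eq_abs,
      Real.rpow_neg hpos.le, Real.rpow_two]
    have e1 : |x| - 1 ≤ |x| ^ p := by
      have := one_add_mul_self_le_rpow_one_add (s := |x| - 1) (by linarith [abs_nonneg x]) hp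
      simp only [add_sub_cancel] at this
      rcases le_total 1 |x| with h | h
      · nlinarith
      · have : 0 ≤ |x| ^ p := by positivity
        linarith
    have e2 := Real.pow_div_factorial_le_exp (1 + |x|) hpos.le (K + 2)
    rw [div_le_iff₀ (by positivity)] at e2
    have e3 : Real.exp (-|x| ^ p) ≤ Real.exp 2 * (Real.exp (1 + |x|))⁻¹ := by
      rw [← Real.exp_neg, ← Real.exp_add]
      exact Real.exp_le_exp.2 (by linarith)
    calc (1 + |x|) ^ K * Real.exp (-|x| ^ p)
        ≤ (1 + |x|) ^ K * (Real.exp 2 * (Real.exp (1 + |x|))⁻¹) := by gcongr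
      _ = (1 + |x|) ^ (K + 2) * (Real.exp 2 * (Real.exp (1 + |x|))⁻¹) * ((1 + |x|) ^ 2)⁻¹ := by
          rw [pow_add]; field_simp
      _ ≤ (Real.exp (1 + |x|) * (K + 2).factorial) * (Real.exp 2 * (Real.exp (1 + |x|))⁻¹)
            * ((1 + |x|) ^ 2)⁻¹ := by gcongr
      _ = _ := by field_simp

lemma exp_cont (n : ℕ) (p : ℝ) (hp : 1 ≤ p) :
    Continuous fun x : Fin n → ℝ => Real.exp (-∑ i, |x i| ^ p) := by
  have : ∀ i, Continuous fun x : Fin n → ℝ => |x i| ^ p := fun i =>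
    (continuous_abs.comp (continuous_apply i)).rpow_const (fun x => Or.inr (by linarith))
  fun_prop

lemma intW (n a b c : ℕ) (ha : 1 ≤ a) (p : ℝ) (hp : 1 ≤ p) (g : (Fin n → ℝ) → ℝ)
    (hg : Continuous g) (L : ℕ) (C : ℝ) (hL : ∀ x, |g x| ≤ C * PW n x ^ L) :
    Integrable fun x => g x * fabc n a b c x * Real.exp (-∑ i, |x i| ^ p) := by
  obtain ⟨M, hM⟩ := fabc_le n a b c ha
  have h := Integrable.fintype_prod (ι := Fin n) (μ := fun _ => (volume : Measure ℝ))
    (f := fun _ x => (1 + |x|) ^ (L + M) * Real.exp (-|x| ^ p)) (fun _ => int1 (L + M) p hp)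
  rw [← volume_pi] at h
  refine (h.const_mul C).mono' ((hg.mul (fabc_continuous n a b c)).mul
    (exp_cont n p hp)).aestronglyMeasurable (Filter.Eventually.of_forall fun x => ?_)
  rw [Finset.prod_mul_distrib, Finset.prod_pow, ← Real.exp_sum, Finset.sum_neg_distrib,
    Real.norm_eq_abs, abs_mul, abs_mul, abs_of_nonneg (Real.exp_pos _).le,
    abs_of_nonneg (fabc_nonneg ..), pow_add]
  have := one_le_PW n x
  refine (mul_le_mul_of_nonneg_right (mul_le_mul (hL x) (hM x) (fabc_nonneg ..)
    ((abs_nonneg _).trans (hL x))) (Real.exp_pos _).le).trans (le_of_eq ?_)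
  rw [PW]
  ring

lemma fabc_pos (n a b c : ℕ) (ha : 1 ≤ a) : 0 < fabc n a b c (fun i => (i : ℝ) + 1) := by
  unfold fabc
  refine mul_pos (Finset.prod_pos fun i _ => Finset.prod_pos fun j _ => ?_)
    (Finset.prod_pos fun i _ => by positivity)
  split_ifs with h
  · refine pow_pos (abs_pos.2 (sub_ne_zero.2 (ne_of_lt ?_))) _
    refine pow_lt_pow_left₀ ?_ (by positivity) (by omega)
    have : ((i : ℕ) : ℝ) < (j : ℕ) := by exact_mod_cast h
    linarith
  · exact one_pos

lemma fabc_perm (n a b c : ℕ) (σ : Equiv.Perm (Fin n)) (x : Fin n → ℝ) :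
    fabc n a b c (fun i => x (σ i)) = fabc n a b c x := by
  have key : ∀ y : Fin n → ℝ,
      (∏ i : Fin n, ∏ j : Fin n, if i < j then |y i ^ a - y j ^ a| ^ b else 1) ^ 2
      = ∏ i : Fin n, ∏ j : Fin n, if i ≠ j then |y i ^ a - y j ^ a| ^ b else 1 := by
    intro y
    rw [sq]
    nth_rw 2 [Finset.prod_comm]
    rw [← Finset.prod_mul_distrib]
    refine Finset.prod_congr rfl fun i _ => ?_
    rw [← Finset.prod_mul_distrib]
    refine Finset.prod_congr rfl fun j _ => ?_
    rcases lt_trichotomy i j with h | h | h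
    · simp [h, h.ne, h.not_gt]
    · simp [h]
    · simp [h, h.ne', h.not_gt, abs_sub_comm]
  unfold fabc
  have hnn : ∀ y : Fin n → ℝ,
      0 ≤ (∏ i : Fin n, ∏ j : Fin n, if i < j then |y i ^ a - y j ^ a| ^ b else 1) := by
    intro y
    refine Finset.prod_nonneg fun i _ => Finset.prod_nonneg fun j _ => ?_
    split_ifs <;> positivity
  congr 1
  · refine (sq_eq_sq₀ (hnn _) (hnn _)).1 ?_
    rw [key, key, ← Equiv.prod_comp σ (fun i => ∏ j : Fin n, if i ≠ j then |x i ^ a - x j ^ a| ^ b else 1)]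
    refine Finset.prod_congr rfl fun i _ => ?_
    rw [← Equiv.prod_comp σ (fun j => if σ i ≠ j then |x (σ i) ^ a - x j ^ a| ^ b else 1)]
    simp
  · exact Equiv.prod_comp σ (fun i => |x i| ^ c)

lemma int_perm (n : ℕ) (σ : Equiv.Perm (Fin n)) (F : (Fin n → ℝ) → ℝ) :
    ∫ x : Fin n → ℝ, F (fun i => x (σ i)) = ∫ x, F x := by
  have h := (volume_measurePreserving_piCongrLeft (fun _ : Fin n => ℝ) σ.symm).integral_comp' F
  rw [← h]
  congr 1
  ext x
  congr 1
  ext i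
  have := MeasurableEquiv.piCongrLeft_apply_apply (β := fun _ : Fin n => ℝ) σ.symm x (σ i)
  simpa using this.symm

lemma Mp_perm (n a b c : ℕ) (p : ℝ) (h : ℝ → ℝ) (i j : Fin n) :
    Mp n a b c p (fun x => h (x i)) = Mp n a b c p (fun x => h (x j)) := by
  unfold Mp
  rw [← int_perm n (Equiv.swap i j)]
  congr 1
  ext x
  rw [fabc_perm]
  beta_reduce
  rw [Equiv.swap_apply_left, Equiv.sum_comp (Equiv.swap i j) (fun k => |x k| ^ p)]
lemma fabc_smul (n a b c : ℕ) (r : ℝ) (hr : 0 < r) (x : Fin n → ℝ) :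
    fabc n a b c (r • x) = r ^ (a * b * (n * (n - 1) / 2) + c * n) * fabc n a b c x := by
  unfold fabc
  have h1 : (∏ i : Fin n, |(r • x) i| ^ c) = r ^ (c * n) * ∏ i : Fin n, |x i| ^ c := by
    simp only [Pi.smul_apply, smul_eq_mul, abs_mul, mul_pow, Finset.prod_mul_distrib,
      Finset.prod_const, Finset.card_univ, Fintype.card_fin, abs_of_pos hr, pow_mul]
  have h2 : (∏ i : Fin n, ∏ j : Fin n,
        if i < j then |(r • x) i ^ a - (r • x) j ^ a| ^ b else 1)
      = (∏ i : Fin n, ∏ j : Fin n, if i < j then r ^ (a * b) else 1) *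
        ∏ i : Fin n, ∏ j : Fin n, if i < j then |x i ^ a - x j ^ a| ^ b else 1 := by
    rw [← Finset.prod_mul_distrib]
    refine Finset.prod_congr rfl fun i _ => ?_
    rw [← Finset.prod_mul_distrib]
    refine Finset.prod_congr rfl fun j _ => ?_
    split_ifs
    · simp only [Pi.smul_apply, smul_eq_mul, mul_pow, ← mul_sub, abs_mul, abs_pow,
        abs_of_pos hr, pow_mul]
    · simp
  have h3 : (∏ i : Fin n, ∏ j : Fin n, if i < j then r ^ (a * b) else 1)
      = r ^ (a * b * (n * (n - 1) / 2)) := by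
    rw [pow_mul r (a * b)]
    generalize r ^ (a * b) = q
    have : ∀ i : Fin n, (∏ j : Fin n, if i < j then q else 1) = q ^ (n - 1 - (i : ℕ)) := by
      intro i
      rw [← Fin.card_Ioi i, ← Finset.prod_const, ← Finset.prod_filter]
      congr 1
      ext j; simp
    simp only [this]
    rw [Finset.prod_pow_eq_pow_sum, Fin.sum_univ_eq_sum_range (fun i => n - 1 - i) n,
      Finset.sum_range_reflect (fun i => i) n, Finset.sum_range_id]
  rw [h1, h2, h3, pow_add]
  ring

lemma pow_diff_nonneg (a : ℕ) (t u v : ℝ) (ht : 0 ≤ t) (hu : 0 ≤ u) (hv : 0 ≤ v) :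
    |(u * (1 + t * u ^ 2)) ^ a - (v * (1 + t * v ^ 2)) ^ a|
      ≤ |u ^ a - v ^ a| * Real.exp ((a + 2) * t * (u ^ 2 + v ^ 2)) := by
  rw [← geom_sum₂_mul, ← geom_sum₂_mul, abs_mul, abs_mul]
  have e1 : |u * (1 + t * u ^ 2) - v * (1 + t * v ^ 2)|
      ≤ |u - v| * Real.exp (2 * t * (u ^ 2 + v ^ 2)) := by
    have : u * (1 + t * u ^ 2) - v * (1 + t * v ^ 2)
      = (u - v) * (1 + t * (u ^ 2 + u * v + v ^ 2)) := by ring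
    rw [this, abs_mul, abs_of_nonneg (a := 1 + t * (u ^ 2 + u * v + v ^ 2)) (by positivity)]
    gcongr
    have h := Real.add_one_le_exp (2 * t * (u ^ 2 + v ^ 2))
    have h2 : t * (u ^ 2 + u * v + v ^ 2) ≤ t * (2 * (u ^ 2 + v ^ 2)) := by
      gcongr
      nlinarith [sq_nonneg (u - v), sq_nonneg u, sq_nonneg v]
    linarith
  have b1 : 1 + t * u ^ 2 ≤ Real.exp (t * (u ^ 2 + v ^ 2)) := by
    have := Real.add_one_le_exp (t * (u ^ 2 + v ^ 2))
    have : 0 ≤ t * v ^ 2 := by positivity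
    linarith
  have b2 : 1 + t * v ^ 2 ≤ Real.exp (t * (u ^ 2 + v ^ 2)) := by
    have := Real.add_one_le_exp (t * (u ^ 2 + v ^ 2))
    have : 0 ≤ t * u ^ 2 := by positivity
    linarith
  have e2 : |∑ i ∈ Finset.range a, (u * (1 + t * u ^ 2)) ^ i * (v * (1 + t * v ^ 2)) ^ (a - 1 - i)|
      ≤ |∑ i ∈ Finset.range a, u ^ i * v ^ (a - 1 - i)| *
        Real.exp (a * (t * (u ^ 2 + v ^ 2))) := by
    rw [abs_of_nonneg (Finset.sum_nonneg fun i _ => by positivity),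
      abs_of_nonneg (Finset.sum_nonneg fun i _ => by positivity), Finset.sum_mul]
    refine Finset.sum_le_sum fun i hi => ?_
    rw [Real.exp_nat_mul]
    have hE : 1 ≤ Real.exp (t * (u ^ 2 + v ^ 2)) := Real.one_le_exp (by positivity)
    set E := Real.exp (t * (u ^ 2 + v ^ 2))
    calc (u * (1 + t * u ^ 2)) ^ i * (v * (1 + t * v ^ 2)) ^ (a - 1 - i)
        ≤ (u * E) ^ i * (v * E) ^ (a - 1 - i) := by gcongr
      _ = u ^ i * v ^ (a - 1 - i) * E ^ (i + (a - 1 - i)) := by ring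
      _ ≤ u ^ i * v ^ (a - 1 - i) * E ^ a := by
          have := Finset.mem_range.1 hi
          gcongr
          · omega
  refine (mul_le_mul e2 e1 (abs_nonneg _) (by positivity)).trans (le_of_eq ?_)
  have : (a + 2) * t * (u ^ 2 + v ^ 2)
    = a * (t * (u ^ 2 + v ^ 2)) + 2 * t * (u ^ 2 + v ^ 2) := by ring
  rw [this, Real.exp_add]
  ring

lemma pow_sum_nonneg (a : ℕ) (t u v : ℝ) (ht : 0 ≤ t) (hu : 0 ≤ u) (hv : 0 ≤ v) :
    |(u * (1 + t * u ^ 2)) ^ a + (v * (1 + t * v ^ 2)) ^ a|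
      ≤ |u ^ a + v ^ a| * Real.exp ((a + 2) * t * (u ^ 2 + v ^ 2)) := by
  have hX : 0 ≤ t * (u ^ 2 + v ^ 2) := by positivity
  have hE : Real.exp (t * (u ^ 2 + v ^ 2)) ^ a ≤ Real.exp ((a + 2) * t * (u ^ 2 + v ^ 2)) := by
    rw [← Real.exp_nat_mul]
    exact Real.exp_le_exp.2 (by nlinarith)
  have b1 : 1 + t * u ^ 2 ≤ Real.exp (t * (u ^ 2 + v ^ 2)) := by
    have := Real.add_one_le_exp (t * (u ^ 2 + v ^ 2))
    have : 0 ≤ t * v ^ 2 := by positivity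
    linarith
  have b2 : 1 + t * v ^ 2 ≤ Real.exp (t * (u ^ 2 + v ^ 2)) := by
    have := Real.add_one_le_exp (t * (u ^ 2 + v ^ 2))
    have : 0 ≤ t * u ^ 2 := by positivity
    linarith
  rw [abs_of_nonneg (by positivity), abs_of_nonneg (by positivity), add_mul, mul_pow, mul_pow]
  have c1 := (pow_le_pow_left₀ (by positivity) b1 a).trans hE
  have c2 := (pow_le_pow_left₀ (by positivity) b2 a).trans hE
  gcongr

lemma pow_diff (a : ℕ) (t x y : ℝ) (ht : 0 ≤ t) :
    |(x * (1 + t * x ^ 2)) ^ a - (y * (1 + t * y ^ 2)) ^ a|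
      ≤ |x ^ a - y ^ a| * Real.exp ((a + 2) * t * (x ^ 2 + y ^ 2)) := by
  have h1 := pow_diff_nonneg a t |x| |y| ht (abs_nonneg _) (abs_nonneg _)
  have h2 := pow_sum_nonneg a t |x| |y| ht (abs_nonneg _) (abs_nonneg _)
  simp only [sq_abs] at h1 h2
  rcases Nat.even_or_odd a with ha | ha
  · simpa only [mul_pow, ha.pow_abs] using h1
  · rcases abs_cases x with ⟨hx, _⟩ | ⟨hx, _⟩ <;> rcases abs_cases y with ⟨hy, _⟩ | ⟨hy, _⟩ <;>
      rw [hx, hy] at h1 h2 <;> try simp only [neg_mul, ha.neg_pow] at h1 h2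
    · exact h1
    · simpa only [← sub_eq_add_neg] using h2
    · rw [← abs_neg, ← abs_neg (x ^ a - y ^ a)]
      convert h2 using 3 <;> ring
    · rw [← abs_neg, ← abs_neg (x ^ a - y ^ a)]
      convert h1 using 3 <;> ring

/-- the deformation -/
noncomputable def phi (n : ℕ) (t : ℝ) (x : Fin n → ℝ) : Fin n → ℝ :=
  fun i => x i * (1 + t * x i ^ 2)

lemma fabc_phi (n a b c : ℕ) (t : ℝ) (ht : 0 ≤ t) (x : Fin n → ℝ) :
    fabc n a b c (phi n t x) ≤ fabc n a b c x *
      Real.exp (t * ((2 * b * (a + 2) * n + c) * ∑ i, x i ^ 2)) := by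
  unfold fabc
  have h1 : (∏ i : Fin n, |phi n t x i| ^ c) ≤ (∏ i : Fin n, |x i| ^ c) *
      Real.exp (t * (c * ∑ i, x i ^ 2)) := by
    rw [Finset.mul_sum, Finset.mul_sum, Real.exp_sum, ← Finset.prod_mul_distrib]
    refine Finset.prod_le_prod (fun i _ => by positivity) fun i _ => ?_
    have : t * (c * x i ^ 2) = c * (t * x i ^ 2) := by ring
    rw [this, Real.exp_nat_mul, phi, ← mul_pow, abs_mul,
      abs_of_nonneg (a := 1 + t * x i ^ 2) (by positivity)]
    gcongr
    linarith [Real.add_one_le_exp (t * x i ^ 2)]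
  have h2 : (∏ i : Fin n, ∏ j : Fin n,
        if i < j then |phi n t x i ^ a - phi n t x j ^ a| ^ b else 1)
      ≤ (∏ i : Fin n, ∏ j : Fin n, if i < j then |x i ^ a - x j ^ a| ^ b else 1) *
        Real.exp (t * ((2 * b * (a + 2) * n) * ∑ i, x i ^ 2)) := by
    have hs : t * ((2 * b * (a + 2) * n) * ∑ i, x i ^ 2)
        = ∑ i : Fin n, ∑ j : Fin n, b * ((a + 2) * t * (x i ^ 2 + x j ^ 2)) := by
      simp only [← Finset.mul_sum, Finset.sum_add_distrib, Finset.sum_const, Finset.card_univ,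
        Fintype.card_fin, nsmul_eq_mul]
      ring
    rw [hs, Real.exp_sum, ← Finset.prod_mul_distrib]
    refine Finset.prod_le_prod (fun i _ => Finset.prod_nonneg fun j _ => ?_) fun i _ => ?_
    · split_ifs <;> positivity
    rw [Real.exp_sum, ← Finset.prod_mul_distrib]
    refine Finset.prod_le_prod (fun j _ => ?_) fun j _ => ?_
    · split_ifs <;> positivity
    split_ifs
    · rw [Real.exp_nat_mul, ← mul_pow]
      exact pow_le_pow_left₀ (abs_nonneg _) (pow_diff a t _ _ ht) _
    · rw [one_mul]
      exact Real.one_le_exp (by positivity)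
  refine (mul_le_mul h2 h1 (Finset.prod_nonneg fun i _ => by positivity) ?_).trans (le_of_eq ?_)
  · refine mul_nonneg (Finset.prod_nonneg fun i _ => Finset.prod_nonneg fun j _ => ?_)
      (Real.exp_pos _).le
    split_ifs <;> positivity
  · rw [add_mul _ (c : ℝ), mul_add t, Real.exp_add]
    ring

lemma phi1_deriv (t x : ℝ) :
    HasDerivAt (fun x : ℝ => x * (1 + t * x ^ 2)) (1 + 3 * t * x ^ 2) x := by
  have := (hasDerivAt_id' x).fun_mul (((hasDerivAt_pow 2 x).const_mul t).const_add 1)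
  refine this.congr_deriv ?_
  push_cast
  ring

lemma phi1_strictMono (t : ℝ) (ht : 0 ≤ t) : StrictMono (fun x : ℝ => x * (1 + t * x ^ 2)) := by
  refine strictMono_of_deriv_pos fun x => ?_
  rw [(phi1_deriv t x).deriv]
  positivity

lemma phi1_surj (t : ℝ) (ht : 0 ≤ t) :
    Function.Surjective (fun x : ℝ => x * (1 + t * x ^ 2)) := by
  refine Continuous.surjective (by fun_prop) ?_ ?_
  · refine Filter.tendsto_atTop_mono' _ ?_ Filter.tendsto_id
    filter_upwards [Filter.eventually_ge_atTop 0] with x hx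
    have : 0 ≤ x * (t * x ^ 2) := by positivity
    simp only [id]; linarith
  · refine Filter.tendsto_atBot_mono' _ ?_ Filter.tendsto_id
    filter_upwards [Filter.eventually_le_atBot 0] with x hx
    have : 0 ≤ (-x) * (t * x ^ 2) := mul_nonneg (by linarith) (by positivity)
    simp only [id]; linarith

lemma int_phi (n : ℕ) (t : ℝ) (ht : 0 ≤ t) (F : (Fin n → ℝ) → ℝ) :
    ∫ x, F x = ∫ x, (∏ i, (1 + 3 * t * x i ^ 2)) * F (phi n t x) := by
  have h := integral_image_eq_integral_abs_det_fderiv_smul (volume : Measure (Fin n → ℝ))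
    (s := Set.univ) (f := phi n t)
    (f' := fun x => ContinuousLinearMap.pi fun i =>
      ((1 + 3 * t * x i ^ 2) • ContinuousLinearMap.id ℝ ℝ) ∘SL ContinuousLinearMap.proj i)
    MeasurableSet.univ ?_ ?_ F
  · have hs : phi n t '' Set.univ = Set.univ := by
      rw [Set.image_univ, Set.range_eq_univ]
      intro y
      choose g hg using phi1_surj t ht
      exact ⟨fun i => g (y i), funext fun i => hg (y i)⟩
    rw [hs] at h
    simp only [Measure.restrict_univ, ContinuousLinearMap.det_pi] at h
    rw [h]
    congr 1
    ext x
    have : ∀ r : ℝ, (r • ContinuousLinearMap.id ℝ ℝ).det = r := by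
      intro r
      simp [ContinuousLinearMap.det]
    simp only [this, smul_eq_mul]
    rw [abs_of_nonneg (Finset.prod_nonneg fun i _ => by positivity)]
  · intro x _
    refine HasFDerivAt.hasFDerivWithinAt (hasFDerivAt_pi.2 fun i => ?_)
    have := (phi1_deriv t (x i)).hasFDerivAt.comp x
      (ContinuousLinearMap.proj (R := ℝ) (φ := fun _ : Fin n => ℝ) i).hasFDerivAt
    refine this.congr_fderiv ?_
    ext v
    simp [mul_comm]
  · intro x _ y _ hxy
    ext i
    exact (phi1_strictMono t ht).injective (congrFun hxy i)
lemma rpow_le_PW (n : ℕ) (x : Fin n → ℝ) (i : Fin n) (q : ℝ) (hq : 0 ≤ q) (L : ℕ) (h : q ≤ L) :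
    |x i| ^ q ≤ PW n x ^ L := by
  have h1 := one_le_PW n x
  rw [← Real.rpow_natCast]
  exact (Real.rpow_le_rpow (abs_nonneg _) (abs_le_PW n x i) hq).trans
    (Real.rpow_le_rpow_of_exponent_le h1 h)

lemma cont_rpow (n : ℕ) (q : ℝ) (hq : 0 ≤ q) (i : Fin n) :
    Continuous fun x : Fin n → ℝ => |x i| ^ q :=
  (continuous_abs.comp (continuous_apply i)).rpow_const (fun x => Or.inr hq)

lemma int_rpow (n a b c : ℕ) (ha : 1 ≤ a) (p : ℝ) (hp : 1 ≤ p) (i : Fin n) (q : ℝ) (hq : 0 ≤ q) :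
    Integrable fun x : Fin n → ℝ =>
      |x i| ^ q * fabc n a b c x * Real.exp (-∑ i, |x i| ^ p) := by
  refine intW n a b c ha p hp _ (cont_rpow n q hq i) ⌈q⌉₊ 1 fun x => ?_
  rw [abs_of_nonneg (by positivity), one_mul]
  exact rpow_le_PW n x i q hq _ (Nat.le_ceil q)

lemma int_one (n a b c : ℕ) (ha : 1 ≤ a) (p : ℝ) (hp : 1 ≤ p) :
    Integrable fun x : Fin n → ℝ =>
      1 * fabc n a b c x * Real.exp (-∑ i, |x i| ^ p) := by
  refine intW n a b c ha p hp _ continuous_const 0 1 fun x => ?_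
  simp

lemma Mp_sum_rpow (n a b c : ℕ) (ha : 1 ≤ a) (p : ℝ) (hp : 1 ≤ p) (i₀ : Fin n)
    (q : ℝ) (hq : 0 ≤ q) :
    Mp n a b c p (fun x => ∑ i, |x i| ^ q) = n * Mp n a b c p (fun x => |x i₀| ^ q) := by
  have h : Mp n a b c p (fun x => ∑ i, |x i| ^ q)
      = ∑ i, Mp n a b c p (fun x => |x i| ^ q) := by
    unfold Mp
    rw [← integral_finsetSum _ fun i _ => int_rpow n a b c ha p hp i q hq]
    simp only [Finset.sum_mul]
  rw [h, Finset.sum_congr rfl fun i _ => Mp_perm n a b c p (fun y => |y| ^ q) i i₀]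
  simp

lemma int_sum_rpow (n a b c : ℕ) (ha : 1 ≤ a) (p : ℝ) (hp : 1 ≤ p) (q : ℝ) (hq : 0 ≤ q) :
    Integrable fun x : Fin n → ℝ =>
      (∑ i, |x i| ^ q) * fabc n a b c x * Real.exp (-∑ i, |x i| ^ p) := by
  simp only [Finset.sum_mul]
  exact integrable_finsetSum _ fun i _ => int_rpow n a b c ha p hp i q hq

lemma Mp_one_pos (n a b c : ℕ) (ha : 1 ≤ a) (p : ℝ) (hp : 1 ≤ p) :
    0 < Mp n a b c p (fun _ => 1) := by
  refine integral_pos_of_integrable_nonneg_nonzero (x := fun i : Fin n => (i : ℝ) + 1)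
    ((continuous_const.mul (fabc_continuous n a b c)).mul (exp_cont n p hp))
    (int_one n a b c ha p hp) (fun x => ?_) (ne_of_gt ?_)
  · have := fabc_nonneg n a b c x
    simp only [Pi.zero_apply]
    positivity
  · have := fabc_pos n a b c ha
    positivity

lemma Mp_rpow_pos (n a b c : ℕ) (ha : 1 ≤ a) (p : ℝ) (hp : 1 ≤ p) (i : Fin n)
    (q : ℝ) (hq : 0 ≤ q) :
    0 < Mp n a b c p (fun x => |x i| ^ q) := by
  refine integral_pos_of_integrable_nonneg_nonzero (x := fun i : Fin n => (i : ℝ) + 1)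
    (((cont_rpow n q hq i).mul (fabc_continuous n a b c)).mul (exp_cont n p hp))
    (int_rpow n a b c ha p hp i q hq) (fun x => ?_) (ne_of_gt ?_)
  · have := fabc_nonneg n a b c x
    simp only [Pi.zero_apply]
    positivity
  · have := fabc_pos n a b c ha
    have h2 : 0 < |((i : ℕ) : ℝ) + 1| := by positivity
    positivity

lemma lower_p (n a b c : ℕ) (ha : 1 ≤ a) (hb : 1 ≤ b) (hn : 1 ≤ n) (p : ℝ) (hp : 1 ≤ p)
    (i₀ : Fin n) :
    n / (4 * p) * Mp n a b c p (fun _ => 1) ≤ Mp n a b c p (fun x => |x i₀| ^ p) := by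
  have hp0 : 0 < p := by linarith
  have hn0 : (0 : ℝ) < n := by exact_mod_cast hn
  set Z := Mp n a b c p (fun _ => 1) with hZ
  have hZpos : 0 < Z := Mp_one_pos n a b c ha p hp
  set T := Mp n a b c p (fun x => ∑ i, |x i| ^ p) with hT
  have hTeq : T = n * Mp n a b c p (fun x => |x i₀| ^ p) := Mp_sum_rpow n a b c ha p hp i₀ p hp0.le
  set Y := ∫ x : Fin n → ℝ, fabc n a b c x * Real.exp (-(2 * ∑ i, |x i| ^ p)) with hY
  set l : ℝ := 2 ^ (1 / p) with hl
  have hl0 : 0 < l := by positivity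
  have hlp : l ^ p = 2 := by
    rw [hl, ← Real.rpow_mul (by norm_num), one_div, inv_mul_cancel₀ hp0.ne', Real.rpow_one]
  set D := a * b * (n * (n - 1) / 2) + c * n with hD
  have h1 : Z = l ^ (n + D) * Y := by
    have h := Measure.integral_comp_smul (volume : Measure (Fin n → ℝ))
      (fun x : Fin n → ℝ => 1 * fabc n a b c x * Real.exp (-∑ i, |x i| ^ p)) l
    have h2 : ∀ x : Fin n → ℝ, 1 * fabc n a b c (l • x) * Real.exp (-∑ i, |(l • x) i| ^ p)
        = l ^ D * (fabc n a b c x * Real.exp (-(2 * ∑ i, |x i| ^ p))) := by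
      intro x
      rw [fabc_smul n a b c l hl0 x, Finset.mul_sum]
      have : ∀ i, |(l • x) i| ^ p = 2 * |x i| ^ p := by
        intro i
        rw [Pi.smul_apply, smul_eq_mul, abs_mul, abs_of_pos hl0,
          Real.mul_rpow hl0.le (abs_nonneg _), hlp]
      simp only [this]
      ring
    simp only [h2] at h
    rw [integral_const_mul, ← hY] at h
    change _ = _ • Z at h
    rw [smul_eq_mul, abs_of_pos (by positivity)] at h
    simp only [Module.finrank_fintype_fun_eq_card, Fintype.card_fin] at h
    rw [pow_add, mul_assoc, h]
    field_simp
  have h3 : Real.exp (-(T / Z)) * Z ≤ Y := by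
    set m := T / Z with hm
    have hmT : m * Z = T := by rw [hm]; field_simp
    have hYint : Integrable fun x : Fin n → ℝ =>
        fabc n a b c x * Real.exp (-(2 * ∑ i, |x i| ^ p)) := by
      refine (int_one n a b c ha p hp).mono' ?_ (Filter.Eventually.of_forall fun x => ?_)
      · refine ((fabc_continuous n a b c).mul ?_).aestronglyMeasurable
        have := fun i => cont_rpow n p hp0.le i
        fun_prop
      · have := fabc_nonneg n a b c x
        rw [Real.norm_eq_abs, abs_of_nonneg (by positivity), one_mul]
        have h5 : 0 ≤ ∑ i, |x i| ^ p := Finset.sum_nonneg fun i _ => by positivity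
        gcongr
        linarith
    have hI1 := (int_one n a b c ha p hp).const_mul (Real.exp (-m) * (1 + m))
    have hI2 := (int_sum_rpow n a b c ha p hp p hp0.le).const_mul (Real.exp (-m))
    have := integral_mono (hI1.sub hI2) hYint (fun x => ?_)
    · simp only [Pi.sub_apply] at this
      rw [integral_sub hI1 hI2, integral_const_mul, integral_const_mul] at this
      change Real.exp (-m) * (1 + m) * Z - Real.exp (-m) * T ≤ Y at this
      rw [← hmT] at this
      linarith
    · simp only [Pi.sub_apply]
      set S := ∑ i, |x i| ^ p
      have hf := fabc_nonneg n a b c x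
      have e1 : Real.exp (-(2 * S)) = Real.exp (-S) * (Real.exp (-m) * Real.exp (m - S)) := by
        rw [← Real.exp_add, ← Real.exp_add]
        congr 1; ring
      rw [e1]
      have e2 := Real.add_one_le_exp (m - S)
      calc _ = fabc n a b c x * (Real.exp (-S) * (Real.exp (-m) * (m - S + 1))) := by ring
        _ ≤ _ := by gcongr
  have h4 : l ^ (n + D) ≤ Real.exp (T / Z) := by
    rw [Real.exp_neg] at h3
    have h5 : l ^ (n + D) * ((Real.exp (T / Z))⁻¹ * Z) ≤ Z := by
      conv_rhs => rw [h1]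
      gcongr
    have h6 : l ^ (n + D) * (Real.exp (T / Z))⁻¹ ≤ 1 := by
      by_contra hcon
      push Not at hcon
      nlinarith
    rwa [← div_eq_mul_inv, div_le_one (Real.exp_pos _)] at h6
  have h5 : ((n + D : ℕ) : ℝ) * (Real.log 2 / p) ≤ T / Z := by
    have := Real.log_le_log (by positivity) h4
    rw [Real.log_exp, Real.log_pow, hl, Real.log_rpow (by norm_num)] at this
    convert this using 2
    ring
  have h6 : (n : ℝ) ^ 2 / 2 ≤ ((n + D : ℕ) : ℝ) := by
    have hev : 2 * (n * (n - 1) / 2) = n * (n - 1) :=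
      Nat.mul_div_cancel' (Nat.even_mul_pred_self n).two_dvd
    have hab : 1 ≤ a * b := Nat.mul_pos ha hb
    have h7 : n * (n - 1) / 2 ≤ a * b * (n * (n - 1) / 2) := Nat.le_mul_of_pos_left _ hab
    have h8 : n ^ 2 = n * (n - 1) + n := by
      obtain ⟨k, rfl⟩ : ∃ k, n = k + 1 := ⟨n - 1, by omega⟩
      simp; ring
    have h9 : n ^ 2 ≤ 2 * (n + D) := by
      have : 0 ≤ c * n := Nat.zero_le _
      omega
    have : ((n ^ 2 : ℕ) : ℝ) ≤ ((2 * (n + D) : ℕ) : ℝ) := by exact_mod_cast h9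
    push_cast at this ⊢
    linarith
  have hlog : (1 : ℝ) / 2 ≤ Real.log 2 := by linarith [Real.log_two_gt_d9]
  have h7 : (n : ℝ) ^ 2 / 2 * (1 / 2 / p) ≤ T / Z := by
    refine le_trans ?_ h5
    gcongr
  rw [hTeq, le_div_iff₀ hZpos] at h7
  have h8 : (n : ℝ) * (n / (4 * p) * Z) ≤ n * Mp n a b c p (fun x => |x i₀| ^ p) := by
    refine le_trans (le_of_eq ?_) h7
    field_simp; ring
  exact le_of_mul_le_mul_left h8 hn0

/-- the function whose mean is shown to be nonnegative -/
noncomputable def GG (n : ℕ) (C p : ℝ) (x : Fin n → ℝ) : ℝ :=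
  C * (∑ i, |x i| ^ (2 : ℝ)) - p * ∑ i, |x i| ^ (p + 2)

lemma GG_cont (n : ℕ) (C p : ℝ) (hp : 1 ≤ p) : Continuous (GG n C p) := by
  unfold GG
  have h1 := fun i => cont_rpow n 2 (by norm_num) i
  have h2 := fun i => cont_rpow n (p + 2) (by linarith) i
  fun_prop

lemma GG_le (n : ℕ) (C p : ℝ) (hC : 1 ≤ C) (hp : 1 ≤ p) (x : Fin n → ℝ) :
    GG n C p x ≤ n * C ^ 3 := by
  have h : ∀ i, C * |x i| ^ (2 : ℝ) - p * |x i| ^ (p + 2) ≤ C ^ 3 := by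
    intro i
    rcases le_total C |x i| with h | h
    · have h0 : 0 < |x i| := by linarith
      have h1 : |x i| ≤ |x i| ^ p := by
        have := Real.rpow_le_rpow_of_exponent_le (x := |x i|) (by linarith) hp
        simpa using this
      rw [Real.rpow_add h0]
      have h2 : 0 ≤ |x i| ^ (2 : ℝ) := by positivity
      have h3 : C ≤ p * |x i| ^ p := by nlinarith
      have h4 : 0 ≤ C ^ 3 := by positivity
      have h5 := mul_le_mul_of_nonneg_right h3 h2
      rw [mul_assoc] at h5
      linarith
    · have h1 : 0 ≤ p * |x i| ^ (p + 2) := by positivity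
      have h2 : |x i| ^ (2 : ℝ) ≤ C ^ 2 := by
        rw [Real.rpow_two]; gcongr
      nlinarith
  have := Finset.sum_le_sum fun i (_ : i ∈ Finset.univ) => h i
  rw [Finset.sum_sub_distrib, ← Finset.mul_sum, ← Finset.mul_sum] at this
  simpa [GG] using this

lemma GG_abs (n : ℕ) (C p : ℝ) (hC : 1 ≤ C) (hp : 1 ≤ p) (x : Fin n → ℝ) :
    |GG n C p x| ≤ (C * n + p * n) * PW n x ^ ⌈p + 2⌉₊ := by
  have h1 : ∑ i, |x i| ^ (2 : ℝ) ≤ n * PW n x ^ ⌈p + 2⌉₊ := by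
    have := Finset.sum_le_sum fun i (_ : i ∈ Finset.univ) =>
      rpow_le_PW n x i 2 (by norm_num) ⌈p + 2⌉₊ ((by linarith : (2 : ℝ) ≤ p + 2).trans (Nat.le_ceil _))
    simpa using this
  have h2 : ∑ i, |x i| ^ (p + 2) ≤ n * PW n x ^ ⌈p + 2⌉₊ := by
    have := Finset.sum_le_sum fun i (_ : i ∈ Finset.univ) =>
      rpow_le_PW n x i (p + 2) (by linarith) ⌈p + 2⌉₊ (Nat.le_ceil _)
    simpa using this
  have h3 : 0 ≤ ∑ i, |x i| ^ (2 : ℝ) := Finset.sum_nonneg fun i _ => by positivity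
  have h4 : 0 ≤ ∑ i, |x i| ^ (p + 2) := Finset.sum_nonneg fun i _ => by positivity
  unfold GG
  rw [abs_le]
  constructor <;> nlinarith

lemma pointwise_phi (n a b c : ℕ) (C p t : ℝ) (hp : 1 ≤ p) (ht : 0 ≤ t)
    (hC : 2 * b * (a + 2) * n + c + 3 ≤ C) (x : Fin n → ℝ) :
    (∏ i, (1 + 3 * t * x i ^ 2)) *
      (1 * fabc n a b c (phi n t x) * Real.exp (-∑ i, |phi n t x i| ^ p)) ≤
    Real.exp (t * GG n C p x) * fabc n a b c x * Real.exp (-∑ i, |x i| ^ p) := by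
  have hQ : ∑ i, |x i| ^ (2 : ℝ) = ∑ i, x i ^ 2 := by simp
  have hQ0 : 0 ≤ ∑ i, x i ^ 2 := Finset.sum_nonneg fun i _ => by positivity
  have h1 : (∏ i, (1 + 3 * t * x i ^ 2)) ≤ Real.exp (t * (3 * ∑ i, x i ^ 2)) := by
    rw [Finset.mul_sum, Finset.mul_sum, Real.exp_sum]
    refine Finset.prod_le_prod (fun i _ => by positivity) fun i _ => ?_
    linarith [Real.add_one_le_exp (t * (3 * x i ^ 2))]
  have h2 := fabc_phi n a b c t ht x
  have h3 : Real.exp (-∑ i, |phi n t x i| ^ p) ≤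
      Real.exp (-∑ i, |x i| ^ p) * Real.exp (-(t * (p * ∑ i, |x i| ^ (p + 2)))) := by
    rw [← Real.exp_add]
    refine Real.exp_le_exp.2 ?_
    have : ∑ i, |x i| ^ p + t * (p * ∑ i, |x i| ^ (p + 2)) ≤ ∑ i, |phi n t x i| ^ p := by
      rw [Finset.mul_sum, Finset.mul_sum, ← Finset.sum_add_distrib]
      refine Finset.sum_le_sum fun i _ => ?_
      have hk : 0 ≤ t * x i ^ 2 := by positivity
      rw [phi, abs_mul, abs_of_nonneg (a := 1 + t * x i ^ 2) (by positivity),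
        Real.mul_rpow (abs_nonneg _) (by positivity),
        Real.rpow_add_of_nonneg (abs_nonneg _) (by linarith) (by norm_num), Real.rpow_two, sq_abs]
      have := one_add_mul_self_le_rpow_one_add (s := t * x i ^ 2) (by linarith) hp
      calc _ = |x i| ^ p * (1 + p * (t * x i ^ 2)) := by ring
        _ ≤ _ := by gcongr
    linarith
  have hf := fabc_nonneg n a b c x
  have hf' := fabc_nonneg n a b c (phi n t x)
  calc _ ≤ Real.exp (t * (3 * ∑ i, x i ^ 2)) * (1 * (fabc n a b c x *
          Real.exp (t * ((2 * b * (a + 2) * n + c) * ∑ i, x i ^ 2))) *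
          (Real.exp (-∑ i, |x i| ^ p) * Real.exp (-(t * (p * ∑ i, |x i| ^ (p + 2)))))) := by
        gcongr
    _ = Real.exp (t * (3 * ∑ i, x i ^ 2) + t * ((2 * b * (a + 2) * n + c) * ∑ i, x i ^ 2) +
          (-(t * (p * ∑ i, |x i| ^ (p + 2))))) * fabc n a b c x * Real.exp (-∑ i, |x i| ^ p) := by
        rw [Real.exp_add, Real.exp_add]; ring
    _ ≤ _ := by
        gcongr
        unfold GG
        rw [hQ]
        have := mul_le_mul_of_nonneg_left (mul_le_mul_of_nonneg_right hC hQ0) ht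
        linarith

lemma loop_ineq (n a b c : ℕ) (ha : 1 ≤ a) (C p : ℝ) (hp : 1 ≤ p) (hC1 : 1 ≤ C)
    (hC : 2 * b * (a + 2) * n + c + 3 ≤ C) :
    0 ≤ ∫ x : Fin n → ℝ, GG n C p x * fabc n a b c x * Real.exp (-∑ i, |x i| ^ p) := by
  set M := (n : ℝ) * C ^ 3 with hM
  have hM0 : 0 ≤ M := by positivity
  have hexp : ∀ t : ℝ, 0 ≤ t → t ≤ 1 → ∀ x, Real.exp (t * GG n C p x) ≤ Real.exp M := by
    intro t h0 h1 x
    refine Real.exp_le_exp.2 ?_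
    have := GG_le n C p hC1 hp x
    rw [← hM] at this
    nlinarith
  have hcE : ∀ t : ℝ, Continuous fun x => Real.exp (t * GG n C p x) := fun t => by
    have := GG_cont n C p hp
    fun_prop
  have hbound : ∀ t : ℝ, 0 ≤ t → t ≤ 1 → ∀ x, |GG n C p x * Real.exp (t * GG n C p x)|
      ≤ |GG n C p x| * Real.exp M := by
    intro t h0 h1 x
    rw [abs_mul, abs_of_pos (Real.exp_pos _)]
    exact mul_le_mul_of_nonneg_left (hexp t h0 h1 x) (abs_nonneg _)
  have hint : ∀ t : ℝ, 0 ≤ t → t ≤ 1 → Integrable fun x : Fin n → ℝ =>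
      (GG n C p x * Real.exp (t * GG n C p x)) * fabc n a b c x *
        Real.exp (-∑ i, |x i| ^ p) := by
    intro t h0 h1
    refine intW n a b c ha p hp _ ((GG_cont n C p hp).mul (hcE t)) ⌈p + 2⌉₊
      ((C * n + p * n) * Real.exp M) fun x => ?_
    refine (hbound t h0 h1 x).trans ?_
    have := mul_le_mul_of_nonneg_right (GG_abs n C p hC1 hp x) (Real.exp_pos M).le
    linarith
  have hintE : ∀ t : ℝ, 0 ≤ t → t ≤ 1 → Integrable fun x : Fin n → ℝ =>
      Real.exp (t * GG n C p x) * fabc n a b c x * Real.exp (-∑ i, |x i| ^ p) := by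
    intro t h0 h1
    refine intW n a b c ha p hp _ (hcE t) 0 (Real.exp M) fun x => ?_
    rw [abs_of_pos (Real.exp_pos _), pow_zero, mul_one]
    exact hexp t h0 h1 x
  have hpos : ∀ t : ℝ, 0 < t → t ≤ 1 → 0 ≤ ∫ x : Fin n → ℝ,
      (GG n C p x * Real.exp (t * GG n C p x)) * fabc n a b c x *
        Real.exp (-∑ i, |x i| ^ p) := by
    intro t h0 h1
    have e1 := int_phi n t h0.le
      (fun x : Fin n → ℝ => 1 * fabc n a b c x * Real.exp (-∑ i, |x i| ^ p))
    have e2 := integral_mono_of_nonneg (μ := (volume : Measure (Fin n → ℝ)))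
      (f := fun x => (∏ i, (1 + 3 * t * x i ^ 2)) *
        (1 * fabc n a b c (phi n t x) * Real.exp (-∑ i, |phi n t x i| ^ p)))
      (Filter.Eventually.of_forall fun x => by
        have := fabc_nonneg n a b c (phi n t x)
        have h2 : 0 ≤ (∏ i, (1 + 3 * t * x i ^ 2)) := Finset.prod_nonneg fun i _ => by positivity
        simp only [Pi.zero_apply]
        positivity) (hintE t h0.le h1)
      (Filter.Eventually.of_forall fun x => pointwise_phi n a b c C p t hp h0.le hC x)
    rw [← e1] at e2
    have e3 := integral_mono (hintE t h0.le h1)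
      ((int_one n a b c ha p hp).add ((hint t h0.le h1).const_mul t)) (fun x => by
        simp only [Pi.add_apply]
        have hf := fabc_nonneg n a b c x
        have h2 : Real.exp (t * GG n C p x) ≤
            1 + t * (GG n C p x * Real.exp (t * GG n C p x)) := by
          have h3 := Real.add_one_le_exp (-(t * GG n C p x))
          have h4 : Real.exp (-(t * GG n C p x)) * Real.exp (t * GG n C p x) = 1 := by
            rw [← Real.exp_add]; simp
          nlinarith [Real.exp_pos (t * GG n C p x)]
        have h5 := mul_le_mul_of_nonneg_right h2
          (mul_nonneg hf (Real.exp_pos (-∑ i, |x i| ^ p)).le)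
        linarith)
    simp only [Pi.add_apply] at e3
    rw [integral_add (int_one n a b c ha p hp) ((hint t h0.le h1).const_mul t),
      integral_const_mul] at e3
    have e4 := e2.trans e3
    have e5 : 0 ≤ t * ∫ x : Fin n → ℝ, (GG n C p x * Real.exp (t * GG n C p x)) *
      fabc n a b c x * Real.exp (-∑ i, |x i| ^ p) := by linarith
    exact nonneg_of_mul_nonneg_right e5 h0
  have hlim := tendsto_integral_of_dominated_convergence (μ := (volume : Measure (Fin n → ℝ)))
    (F := fun (k : ℕ) x => (GG n C p x * Real.exp (1 / ((k : ℝ) + 1) * GG n C p x)) *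
      fabc n a b c x * Real.exp (-∑ i, |x i| ^ p))
    (f := fun x => GG n C p x * fabc n a b c x * Real.exp (-∑ i, |x i| ^ p))
    (fun x => (|GG n C p x| * Real.exp M) * fabc n a b c x * Real.exp (-∑ i, |x i| ^ p))
    ?_ ?_ ?_ ?_
  · refine ge_of_tendsto' hlim fun k => hpos _ (by positivity) ?_
    rw [div_le_one (by positivity)]
    have : (0 : ℝ) ≤ k := by positivity
    linarith
  · intro k
    exact (((GG_cont n C p hp).mul (hcE _)).mul (fabc_continuous n a b c)).mul
      (exp_cont n p hp) |>.aestronglyMeasurable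
  · refine intW n a b c ha p hp _ ((GG_cont n C p hp).abs.mul continuous_const) ⌈p + 2⌉₊
      ((C * n + p * n) * Real.exp M) fun x => ?_
    rw [abs_mul, abs_abs, abs_of_pos (Real.exp_pos _)]
    have := mul_le_mul_of_nonneg_right (GG_abs n C p hC1 hp x) (Real.exp_pos M).le
    linarith
  · intro k
    refine Filter.Eventually.of_forall fun x => ?_
    have hf := fabc_nonneg n a b c x
    rw [Real.norm_eq_abs, abs_mul, abs_of_pos (Real.exp_pos (-∑ i, |x i| ^ p)), abs_mul,
      abs_of_nonneg hf]
    have := hbound (1 / ((k : ℝ) + 1)) (by positivity) (by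
      rw [div_le_one (by positivity)]
      have : (0 : ℝ) ≤ k := by positivity
      linarith) x
    gcongr
  · refine Filter.Eventually.of_forall fun x => ?_
    have h0 : Filter.Tendsto (fun k : ℕ => Real.exp (1 / ((k : ℝ) + 1) * GG n C p x))
        Filter.atTop (nhds 1) := by
      have := (tendsto_one_div_add_atTop_nhds_zero_nat (𝕜 := ℝ)).mul_const (GG n C p x)
      rw [zero_mul] at this
      have h2 := (Real.continuous_exp.tendsto 0).comp this
      rw [Real.exp_zero] at h2
      exact h2
    have := ((h0.const_mul (GG n C p x)).mul_const (fabc n a b c x)).mul_const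
      (Real.exp (-∑ i, |x i| ^ p))
    rw [mul_one] at this
    exact this

lemma loop (n a b c : ℕ) (ha : 1 ≤ a) (hn : 1 ≤ n) (p : ℝ) (hp : 1 ≤ p) (i₀ : Fin n) :
    p * Mp n a b c p (fun x => |x i₀| ^ (p + 2)) ≤
      (3 + c + 2 * b * (a + 2)) * n * Mp n a b c p (fun x => |x i₀| ^ (2 : ℝ)) := by
  have hn1 : (1 : ℝ) ≤ n := by exact_mod_cast hn
  set C : ℝ := (3 + c + 2 * b * (a + 2)) * n with hCdef
  have hc0 : (0 : ℝ) ≤ c := by positivity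
  have hb0 : (0 : ℝ) ≤ 2 * b * (a + 2) := by positivity
  have hC1 : 1 ≤ C := by nlinarith
  have h := loop_ineq n a b c ha C p hp hC1 (by nlinarith)
  have hI1 := (int_sum_rpow n a b c ha p hp 2 (by norm_num)).const_mul C
  have hI2 := (int_sum_rpow n a b c ha p hp (p + 2) (by linarith)).const_mul p
  have h2 : ∀ x : Fin n → ℝ, GG n C p x * fabc n a b c x * Real.exp (-∑ i, |x i| ^ p)
      = C * ((∑ i, |x i| ^ (2 : ℝ)) * fabc n a b c x * Real.exp (-∑ i, |x i| ^ p))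
        - p * ((∑ i, |x i| ^ (p + 2)) * fabc n a b c x * Real.exp (-∑ i, |x i| ^ p)) := by
    intro x; unfold GG; ring
  simp only [h2] at h
  rw [integral_sub hI1 hI2, integral_const_mul, integral_const_mul] at h
  change 0 ≤ C * Mp n a b c p (fun x => ∑ i, |x i| ^ (2 : ℝ))
    - p * Mp n a b c p (fun x => ∑ i, |x i| ^ (p + 2)) at h
  rw [Mp_sum_rpow n a b c ha p hp i₀ _ (by norm_num),
    Mp_sum_rpow n a b c ha p hp i₀ _ (by linarith)] at h
  refine le_of_mul_le_mul_left (a := (n : ℝ)) ?_ (by linarith)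
  linarith

/-- Jensen -/
lemma jensen (n a b c : ℕ) (ha : 1 ≤ a) (p : ℝ) (hp : 1 ≤ p) (i : Fin n) (q r : ℝ)
    (hq : 0 < q) (hqr : q ≤ r) :
    (Mp n a b c p (fun x => |x i| ^ q) / Mp n a b c p (fun _ => 1)) ^ (r / q) ≤
      Mp n a b c p (fun x => |x i| ^ r) / Mp n a b c p (fun _ => 1) := by
  have hZ := Mp_one_pos n a b c ha p hp
  have hQ := Mp_rpow_pos n a b c ha p hp i q hq.le
  set m := Mp n a b c p (fun x => |x i| ^ q) / Mp n a b c p (fun _ => 1) with hm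
  have hm0 : 0 < m := by positivity
  set s := r / q with hs
  have hs1 : 1 ≤ s := (one_le_div hq).2 hqr
  have hmZ : Mp n a b c p (fun x => |x i| ^ q) = m * Mp n a b c p (fun _ => 1) := by
    rw [hm]; field_simp
  rw [le_div_iff₀ hZ]
  have hI1 := (int_one n a b c ha p hp).const_mul (m ^ s * (1 - s))
  have hI2 := (int_rpow n a b c ha p hp i q hq.le).const_mul (m ^ s * (s / m))
  have key := integral_mono (hI1.add hI2) (int_rpow n a b c ha p hp i r (by linarith))
    (fun x => by
      simp only [Pi.add_apply]
      have hf := fabc_nonneg n a b c x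
      have hy : 0 ≤ |x i| ^ q := by positivity
      have h1 := one_add_mul_self_le_rpow_one_add (s := |x i| ^ q / m - 1)
        (by have : 0 ≤ |x i| ^ q / m := by positivity
            linarith) hs1
      have h2 : |x i| ^ r = m ^ s * (|x i| ^ q / m) ^ s := by
        rw [← Real.mul_rpow hm0.le (by positivity), mul_div_cancel₀ _ hm0.ne',
          ← Real.rpow_mul (abs_nonneg _), hs, mul_div_cancel₀ _ hq.ne']
      rw [add_sub_cancel] at h1
      rw [h2]
      calc _ = m ^ s * (1 + s * (|x i| ^ q / m - 1)) * fabc n a b c x *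
            Real.exp (-∑ i, |x i| ^ p) := by ring
        _ ≤ _ := by gcongr)
  simp only [Pi.add_apply] at key
  rw [integral_add hI1 hI2, integral_const_mul, integral_const_mul] at key
  change m ^ s * (1 - s) * Mp n a b c p (fun _ => 1)
    + m ^ s * (s / m) * Mp n a b c p (fun x => |x i| ^ q)
    ≤ Mp n a b c p (fun x => |x i| ^ r) at key
  refine le_trans (le_of_eq ?_) key
  rw [hmZ]
  field_simp
  ring
lemma final_real (C₀ p n A₂ Ap Aq : ℝ) (hC : 1 ≤ C₀) (hp : 1 ≤ p) (hn : 1 ≤ n) (hA2 : 0 < A₂)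
    (hloop : p * Aq ≤ C₀ * n * A₂) (hAp : n / (4 * p) ≤ Ap)
    (hJ1 : Ap ^ ((p + 2) / p) ≤ Aq) (hJ2 : A₂ ^ ((p + 2) / 2) ≤ Aq) :
    1 / (4 * C₀ * Real.exp 8) * n ^ (2 / p) ≤ A₂ ∧ A₂ ≤ C₀ ^ 2 * n ^ (2 / p) := by
  have hp0 : 0 < p := by linarith
  have hn0 : 0 < n := by linarith
  have hC0 : 0 < C₀ := by linarith
  constructor
  · set u := n / (4 * p) with hu
    have hu0 : 0 < u := by positivity
    have h1 : u * u ^ (2 / p) ≤ Aq := by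
      refine le_trans (le_of_eq ?_) ((Real.rpow_le_rpow hu0.le hAp (by positivity)).trans hJ1)
      rw [add_div, div_self hp0.ne', Real.rpow_add hu0, Real.rpow_one]
    have h2 : n * (u ^ (2 / p) / 4) ≤ n * (C₀ * A₂) := by
      have h3 := (mul_le_mul_of_nonneg_left h1 hp0.le).trans hloop
      have h4 : p * (u * u ^ (2 / p)) = n * (u ^ (2 / p) / 4) := by
        generalize u ^ (2 / p) = w
        rw [hu]; field_simp
      rw [h4] at h3
      linarith
    have h3 := le_of_mul_le_mul_left h2 hn0
    have h4 : n ^ (2 / p) ≤ Real.exp 8 * u ^ (2 / p) := by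
      rw [hu, Real.div_rpow hn0.le (by positivity), ← mul_div_assoc, le_div_iff₀ (by positivity),
        mul_comm]
      gcongr
      rw [Real.rpow_def_of_pos (by positivity)]
      refine Real.exp_le_exp.2 ?_
      have := Real.log_le_self (x := 4 * p) (by positivity)
      calc Real.log (4 * p) * (2 / p) ≤ (4 * p) * (2 / p) := by gcongr
        _ = 8 := by field_simp; norm_num
    rw [div_mul_eq_mul_div, one_mul, div_le_iff₀ (by positivity)]
    have := Real.exp_pos 8
    nlinarith
  · have h1 : A₂ ^ (p / 2) ≤ C₀ * n := by
      have h2 : A₂ ^ (p / 2) * A₂ ≤ Aq := by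
        refine le_trans (le_of_eq ?_) hJ2
        rw [add_div, div_self (two_ne_zero), Real.rpow_add hA2, Real.rpow_one]
      have h3 : 0 ≤ A₂ ^ (p / 2) * A₂ := by positivity
      have h4 : A₂ ^ (p / 2) * A₂ ≤ C₀ * n * A₂ := by nlinarith
      exact le_of_mul_le_mul_right h4 hA2
    have h2 := Real.rpow_le_rpow (by positivity) h1 (by positivity : 0 ≤ 2 / p)
    rw [← Real.rpow_mul hA2.le, show p / 2 * (2 / p) = 1 by field_simp, Real.rpow_one,
      Real.mul_rpow hC0.le hn0.le] at h2
    refine h2.trans ?_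
    gcongr
    rw [← Real.rpow_two]
    refine Real.rpow_le_rpow_of_exponent_le hC ?_
    rw [div_le_iff₀ hp0]; linarith

/-- For fixed `a, b ≥ 1` and `c ≥ 0` there are constants `c₁, c₂ > 0`
(depending only on `a, b, c`) such that for all `n ≥ 2` and `p ∈ [1,∞)`,
`c₁ n^{2/p} ≤ M_p(x₁²)/M_p(1) ≤ c₂ n^{2/p}`. -/
theorem statement7 (a b c : ℕ) (ha : 1 ≤ a) (hb : 1 ≤ b) :
    ∃ c₁ c₂ : ℝ, 0 < c₁ ∧ 0 < c₂ ∧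
      ∀ (n : ℕ) (hn : 2 ≤ n) (p : ℝ), 1 ≤ p →
        c₁ * (n : ℝ) ^ (2 / p) ≤
            Mp n a b c p (fun x => x ⟨0, by omega⟩ ^ 2) / Mp n a b c p (fun _ => 1) ∧
          Mp n a b c p (fun x => x ⟨0, by omega⟩ ^ 2) / Mp n a b c p (fun _ => 1) ≤
            c₂ * (n : ℝ) ^ (2 / p) := by
  have hC1 : (1 : ℝ) ≤ 3 + c + 2 * b * (a + 2) := by
    have : (0 : ℝ) ≤ c := by positivity
    have : (0 : ℝ) ≤ 2 * b * (a + 2) := by positivity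
    linarith
  refine ⟨1 / (4 * (3 + c + 2 * b * (a + 2)) * Real.exp 8), (3 + c + 2 * b * (a + 2)) ^ 2,
    by positivity, by positivity, fun n hn p hp => ?_⟩
  have hn0 : 0 < n := by omega
  have hn1 : (1 : ℝ) ≤ n := by exact_mod_cast hn0
  have hp0 : 0 < p := by linarith
  have hZ := Mp_one_pos n a b c ha p hp
  have e : Mp n a b c p (fun x => x ⟨0, hn0⟩ ^ 2)
      = Mp n a b c p (fun x => |x ⟨0, hn0⟩| ^ (2 : ℝ)) := by simp
  rw [e]
  refine final_real _ p n _
    (Mp n a b c p (fun x => |x ⟨0, hn0⟩| ^ p) / Mp n a b c p (fun _ => 1))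
    (Mp n a b c p (fun x => |x ⟨0, hn0⟩| ^ (p + 2)) / Mp n a b c p (fun _ => 1))
    hC1 hp hn1 (div_pos (Mp_rpow_pos n a b c ha p hp _ 2 (by norm_num)) hZ) ?_ ?_ ?_ ?_
  · rw [← mul_div_assoc, ← mul_div_assoc]
    exact div_le_div_of_nonneg_right (loop n a b c ha hn0 p hp ⟨0, hn0⟩) hZ.le
  · rw [le_div_iff₀ hZ]
    exact lower_p n a b c ha hb hn0 p hp _
  · exact jensen n a b c ha p hp _ p (p + 2) hp0 (by linarith)
  · exact jensen n a b c ha p hp _ 2 (p + 2) (by norm_num) (by linarith)
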